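/- Fix 0 < Δ < 1/100 and set Θ := π − Δ/2. Let C₁ > 0 and let ρ be a probability density on [−π,π] with ρ(x) = ρ(−x), supported in [−Θ,Θ], satisfying C₁^{−1}√x ≤ Δ^{1/6}·ρ(Θ−x) ≤ C₁√x for 0 < x < Δ and C₁^{−1}x^{1/3} ≤ ρ(Θ−x) ≤ C₁x^{1/3} for Δ < x < Θ. Then there exist constants c₁ ∈ (0, 1/2) and d > 0, depending only on C₁, such that for every z = (1+η)·e^{i(Θ+κ)} with 0 < η < c₁·Δ and 0 < κ < Δ/2, one has Im f_ρ(z) − Im f_ρ(e^{iΘ}) ≤ −d·Δ^{−1/6}·√κ. -/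

import Mathlib

noncomputable section

/-- The Cauchy transform of an integrable density `ρ` on `[−π, π]`:
`f_ρ(z) = ∫_{−π}^{π} (e^{iθ} + z)/(e^{iθ} − z)·ρ(θ) dθ`. -/
def cauchyTransformD (ρ : ℝ → ℝ) (z : ℂ) : ℂ :=
  ∫ θ in (-Real.pi)..Real.pi,
    ((Complex.exp ((θ : ℂ) * Complex.I) + z) / (Complex.exp ((θ : ℂ) * Complex.I) - z)) *
      (ρ θ : ℂ)

/-- `ρ` is a symmetric probability density on `[−π, π]` supported in `[−Θ, Θ]` with
`Θ = π − Δ/2`, with square-root behavior on scale `Δ^{1/6}` at distance `< Δ` from the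
edge and cube-root behavior further away, with constant `C₁`. -/
def IsCuspDensity (Δ C₁ : ℝ) (ρ : ℝ → ℝ) : Prop :=
  (∀ x, 0 ≤ ρ x) ∧ (∫ x in (-Real.pi)..Real.pi, ρ x) = 1 ∧ (∀ x, ρ x = ρ (-x)) ∧
    (∀ x, Real.pi - Δ / 2 < |x| → ρ x = 0) ∧
    (∀ x, 0 < x → x < Δ →
      C₁⁻¹ * Real.sqrt x ≤ Δ ^ ((1 : ℝ) / 6) * ρ (Real.pi - Δ / 2 - x) ∧
        Δ ^ ((1 : ℝ) / 6) * ρ (Real.pi - Δ / 2 - x) ≤ C₁ * Real.sqrt x) ∧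
    (∀ x, Δ < x → x < Real.pi - Δ / 2 →
      C₁⁻¹ * x ^ ((1 : ℝ) / 3) ≤ ρ (Real.pi - Δ / 2 - x) ∧
        ρ (Real.pi - Δ / 2 - x) ≤ C₁ * x ^ ((1 : ℝ) / 3))

/-- The imaginary part of the Herglotz kernel at angle `α`, in terms of the
regularization parameter `e = (r - 1) ^ 2 / (2 * r)` of the radius `r`. -/
def herglotzIm (e α : ℝ) : ℝ := Real.sin α / (1 + e - Real.cos α)

lemma herglotzIm_two_pi_sub (e α : ℝ) : herglotzIm e (2 * Real.pi - α) = -herglotzIm e α := by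
  simp [herglotzIm, Real.sin_two_pi_sub, Real.cos_two_pi_sub, neg_div]

lemma im_herglotz_kernel (r θ φ : ℝ) (hr : 0 < r) :
    ((Complex.exp ((θ : ℂ) * Complex.I) + (r : ℂ) * Complex.exp ((φ : ℂ) * Complex.I)) /
      (Complex.exp ((θ : ℂ) * Complex.I) - (r : ℂ) * Complex.exp ((φ : ℂ) * Complex.I))).im =
      herglotzIm ((r - 1) ^ 2 / (2 * r)) (φ - θ) := by
  have hn : Complex.normSq
      (Complex.exp ((θ : ℂ) * Complex.I) - (r : ℂ) * Complex.exp ((φ : ℂ) * Complex.I)) =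
      2 * r * (1 + (r - 1) ^ 2 / (2 * r) - Real.cos (φ - θ)) := by
    rw [Complex.normSq_apply]
    simp only [Complex.sub_re, Complex.sub_im, Complex.re_ofReal_mul, Complex.im_ofReal_mul,
      Complex.exp_ofReal_mul_I_re, Complex.exp_ofReal_mul_I_im, Real.cos_sub]
    field_simp
    linear_combination Real.sin_sq_add_cos_sq θ + r ^ 2 * Real.sin_sq_add_cos_sq φ
  rw [Complex.div_im, hn, herglotzIm, ← sub_div, ← mul_div_mul_left (Real.sin (φ - θ)) _
    (by positivity : 2 * r ≠ 0)]
  congr 1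
  simp only [Complex.sub_re, Complex.sub_im, Complex.add_re, Complex.add_im,
    Complex.re_ofReal_mul, Complex.im_ofReal_mul,
    Complex.exp_ofReal_mul_I_re, Complex.exp_ofReal_mul_I_im, Real.sin_sub]
  ring

lemma herglotzIm_zero (α : ℝ) :
    herglotzIm 0 α = Real.cos (α / 2) / Real.sin (α / 2) := by
  have hs : Real.sin α = 2 * Real.sin (α / 2) * Real.cos (α / 2) := by
    rw [← Real.sin_two_mul]; ring_nf
  have hc : Real.cos α = 1 - 2 * Real.sin (α / 2) ^ 2 := by
    have := Real.cos_two_mul (α / 2)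
    have h2 := Real.sin_sq_add_cos_sq (α / 2)
    rw [show 2 * (α / 2) = α by ring] at this
    linarith
  rw [herglotzIm, hs, hc]
  by_cases h : Real.sin (α / 2) = 0
  · simp [h]
  · field_simp
    ring

lemma sin_half_pos {p : ℝ} (h0 : 0 < p) (h1 : p < 2 * Real.pi) : 0 < Real.sin (p / 2) :=
  Real.sin_pos_of_pos_of_lt_pi (by linarith) (by linarith)

lemma herglotzIm_zero_sub {p q : ℝ} (hp0 : 0 < p) (hp : p < 2 * Real.pi)
    (hq0 : 0 < q) (hq : q < 2 * Real.pi) :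
    herglotzIm 0 p - herglotzIm 0 q =
      Real.sin ((q - p) / 2) / (Real.sin (p / 2) * Real.sin (q / 2)) := by
  have h1 := sin_half_pos hp0 hp
  have h2 := sin_half_pos hq0 hq
  rw [herglotzIm_zero, herglotzIm_zero, sub_div, Real.sin_sub]
  field_simp

lemma herglotzIm_zero_antitone {p q : ℝ} (hp0 : 0 < p) (hpq : p ≤ q) (hq : q < 2 * Real.pi) :
    herglotzIm 0 q ≤ herglotzIm 0 p := by
  have h := herglotzIm_zero_sub hp0 (hpq.trans_lt hq) (hp0.trans_le hpq) hq
  have h1 := sin_half_pos hp0 (hpq.trans_lt hq)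
  have h2 := sin_half_pos (hp0.trans_le hpq) hq
  have h3 : 0 ≤ Real.sin ((q - p) / 2) :=
    Real.sin_nonneg_of_nonneg_of_le_pi (by linarith) (by linarith)
  have : 0 ≤ Real.sin ((q - p) / 2) / (Real.sin (p / 2) * Real.sin (q / 2)) := by positivity
  linarith

lemma one_sub_cos_pos {α : ℝ} (h0 : 0 < α) (h1 : α < 2 * Real.pi) : 0 < 1 - Real.cos α := by
  have h := sin_half_pos h0 h1
  have h3 := Real.cos_two_mul (α / 2)
  have h2 := Real.sin_sq_add_cos_sq (α / 2)
  rw [show 2 * (α / 2) = α by ring] at h3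
  nlinarith

lemma herglotzIm_zero_sub_self {e α : ℝ} (he : 0 ≤ e) (h0 : 0 < α) (h1 : α < 2 * Real.pi) :
    herglotzIm 0 α - herglotzIm e α = herglotzIm 0 α * (e / (1 + e - Real.cos α)) := by
  have h := one_sub_cos_pos h0 h1
  have h' : 1 + e - Real.cos α ≠ 0 := by linarith
  have h'' : 1 + 0 - Real.cos α ≠ 0 := by linarith
  simp only [herglotzIm]
  field_simp
  ring

lemma herglotzIm_sub_le {e a b : ℝ} (he : 0 ≤ e) (ha0 : 0 < a) (ha : a < Real.pi)
    (hab : a ≤ b) (hb : b < 2 * Real.pi) :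
    herglotzIm e a - herglotzIm e b ≤ herglotzIm 0 a - herglotzIm 0 b := by
  have pa := herglotzIm_zero_sub_self he ha0 (by linarith)
  have pb := herglotzIm_zero_sub_self he (ha0.trans_le hab) hb
  have ca := one_sub_cos_pos ha0 (by linarith)
  have cb := one_sub_cos_pos (ha0.trans_le hab) hb
  have ka : 0 ≤ herglotzIm 0 a := by
    rw [herglotzIm]
    exact div_nonneg (Real.sin_pos_of_pos_of_lt_pi ha0 ha).le (by linarith)
  have ea : 0 ≤ e / (1 + e - Real.cos a) := div_nonneg he (by linarith)
  have eb : 0 ≤ e / (1 + e - Real.cos b) := div_nonneg he (by linarith)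
  suffices herglotzIm 0 b * (e / (1 + e - Real.cos b)) ≤
      herglotzIm 0 a * (e / (1 + e - Real.cos a)) by linarith
  rcases le_or_gt Real.pi b with hpb | hpb
  · have kb : herglotzIm 0 b ≤ 0 := by
      rw [herglotzIm]
      refine div_nonpos_of_nonpos_of_nonneg ?_ (by linarith)
      have := Real.sin_nonneg_of_nonneg_of_le_pi (x := 2 * Real.pi - b) (by linarith) (by linarith)
      rw [Real.sin_two_pi_sub] at this
      linarith
    exact (mul_nonpos_of_nonpos_of_nonneg kb eb).trans (mul_nonneg ka ea)
  · have hc := Real.cos_le_cos_of_nonneg_of_le_pi ha0.le hpb.le hab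
    refine mul_le_mul (herglotzIm_zero_antitone ha0 hab hb) ?_ eb ka
    exact div_le_div_of_nonneg_left he (by linarith) (by linarith)

/-- The symmetrized change of the kernel when the evaluation point moves into the gap. -/
lemma herglotzIm_symm_le {e κ Δ y : ℝ} (he : 0 ≤ e) (hκ : 0 < κ) (hκΔ : κ < Δ / 2)
    (hΔ : Δ < 1) (hy : 0 < y) (hyπ : y + Δ / 2 < Real.pi) :
    herglotzIm e (y + κ) - herglotzIm e (Δ + y - κ) - herglotzIm 0 y + herglotzIm 0 (Δ + y) ≤
      herglotzIm 0 (y + κ) - herglotzIm 0 y := by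
  have hpi := Real.pi_gt_three
  have h1 := herglotzIm_sub_le (a := y + κ) (b := Δ + y - κ) he (by linarith) (by linarith)
    (by linarith) (by linarith)
  have h2 := herglotzIm_zero_antitone (p := Δ + y - κ) (q := Δ + y) (by linarith) (by linarith)
    (by linarith)
  linarith

lemma herglotzIm_zero_add_sub_le {y κ : ℝ} (hκ : 0 < κ) (hκπ : κ < Real.pi)
    (hy : 0 < y) (hyκ : y ≤ κ) :
    herglotzIm 0 (y + κ) - herglotzIm 0 y ≤ -(1 / (2 * y)) := by
  have hpi := Real.pi_pos
  have h := herglotzIm_zero_sub hy (by linarith) (by linarith : 0 < y + κ) (by linarith)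
  have s1 := sin_half_pos hy (by linarith)
  have s2 := sin_half_pos (by linarith : 0 < y + κ) (by linarith)
  have u1 := Real.sin_lt (by linarith : 0 < y / 2)
  have u2 := Real.sin_lt (by linarith : 0 < (y + κ) / 2)
  have l1 := Real.mul_le_sin (x := κ / 2) (by linarith) (by linarith)
  have hl : κ / 4 ≤ Real.sin (κ / 2) := by
    refine le_trans ?_ l1
    rw [div_mul_div_comm, div_le_div_iff₀ (by norm_num) (by positivity)]
    nlinarith [Real.pi_le_four]
  rw [show (y + κ - y) / 2 = κ / 2 by ring] at h
  suffices 1 / (2 * y) ≤ Real.sin (κ / 2) / (Real.sin (y / 2) * Real.sin ((y + κ) / 2)) by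
    linarith
  rw [div_le_div_iff₀ (by linarith) (by positivity)]
  have : Real.sin (y / 2) * Real.sin ((y + κ) / 2) ≤ y / 2 * κ :=
    mul_le_mul u1.le (by linarith) s2.le (by linarith)
  nlinarith

lemma norm_exp_sub_exp (θ φ : ℝ) :
    ‖Complex.exp ((θ : ℂ) * Complex.I) - Complex.exp ((φ : ℂ) * Complex.I)‖ =
      2 * |Real.sin ((φ - θ) / 2)| := by
  rw [← abs_of_nonneg (norm_nonneg _), ← abs_two, ← abs_mul, abs_two, ← sq_eq_sq_iff_abs_eq_abs,
    ← Complex.normSq_eq_norm_sq, Complex.normSq_apply]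
  simp only [Complex.sub_re, Complex.sub_im, Complex.exp_ofReal_mul_I_re,
    Complex.exp_ofReal_mul_I_im]
  have h3 := Real.cos_two_mul ((φ - θ) / 2)
  have h2 := Real.sin_sq_add_cos_sq ((φ - θ) / 2)
  rw [show 2 * ((φ - θ) / 2) = φ - θ by ring, Real.cos_sub] at h3
  linear_combination Real.sin_sq_add_cos_sq θ + Real.sin_sq_add_cos_sq φ - 2 * h3 - 4 * h2

namespace IsCuspDensity

variable {Δ C₁ : ℝ} {ρ : ℝ → ℝ}

lemma intervalIntegrable (h : IsCuspDensity Δ C₁ ρ) :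
    IntervalIntegrable ρ MeasureTheory.volume (-Real.pi) Real.pi := by
  by_contra hn
  have := intervalIntegral.integral_undef hn
  rw [h.2.1] at this
  exact one_ne_zero this

lemma cauchyKernel_intervalIntegrable (h : IsCuspDensity Δ C₁ ρ) {z : ℂ} (hz : ‖z‖ ≠ 1) :
    IntervalIntegrable (fun θ : ℝ ↦
      ((Complex.exp ((θ : ℂ) * Complex.I) + z) / (Complex.exp ((θ : ℂ) * Complex.I) - z)) *
        (ρ θ : ℂ)) MeasureTheory.volume (-Real.pi) Real.pi := by
  have hρ : IntervalIntegrable (fun θ ↦ (ρ θ : ℂ)) MeasureTheory.volume (-Real.pi) Real.pi :=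
    ⟨h.intervalIntegrable.1.ofReal, h.intervalIntegrable.2.ofReal⟩
  refine hρ.continuousOn_mul (Continuous.continuousOn ?_)
  refine Continuous.div (by fun_prop) (by fun_prop) fun θ h0 ↦ hz ?_
  rw [← sub_eq_zero.mp h0, Complex.norm_exp_ofReal_mul_I]

lemma cauchyKernel_edge_intervalIntegrable (h : IsCuspDensity Δ C₁ ρ) (hC : 0 < C₁) (hΔ0 : 0 < Δ)
    (hΔ1 : Δ < 1 / 100) :
    IntervalIntegrable (fun θ : ℝ ↦
      ((Complex.exp ((θ : ℂ) * Complex.I) +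
          Complex.exp (((Real.pi - Δ / 2 : ℝ) : ℂ) * Complex.I)) /
        (Complex.exp ((θ : ℂ) * Complex.I) -
          Complex.exp (((Real.pi - Δ / 2 : ℝ) : ℂ) * Complex.I))) *
        (ρ θ : ℂ)) MeasureTheory.volume (-Real.pi) Real.pi := by
  have hpi := Real.pi_gt_three
  have hint := h.intervalIntegrable
  obtain ⟨h0, -, -, hsupp, hnear, -⟩ := h
  set Θ := Real.pi - Δ / 2 with hΘ
  set m := Real.sin (Δ / 2) with hm
  have hmpos : 0 < m := Real.sin_pos_of_pos_of_lt_pi (by linarith) (by linarith)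
  have hpow : IntervalIntegrable (fun θ : ℝ ↦ |(Θ - θ) ^ (-(1 / 2) : ℝ)|) MeasureTheory.volume
      (-Real.pi) Real.pi := by
    have := (intervalIntegral.intervalIntegrable_rpow' (a := Θ - -Real.pi) (b := Θ - Real.pi)
      (r := -(1 / 2)) (by norm_num)).comp_sub_left Θ
    simpa using this.abs
  have hmaj := (hint.const_mul (1 / m)).add
    (hpow.const_mul (4 * C₁ / Δ ^ ((1 : ℝ) / 6)))
  refine hmaj.mono_fun ?_ ?_
  · refine MeasureTheory.AEStronglyMeasurable.mul ?_ ?_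
    · exact (by fun_prop : Measurable _).aestronglyMeasurable
    · exact Complex.continuous_ofReal.comp_aestronglyMeasurable hint.def'.aestronglyMeasurable
  · refine Filter.Eventually.of_forall fun θ ↦ ?_
    have hΔp : 0 < Δ ^ ((1 : ℝ) / 6) := Real.rpow_pos_of_pos hΔ0 _
    have hr1 : 0 ≤ 1 / m * ρ θ := mul_nonneg (by positivity) (h0 θ)
    have hr2 : 0 ≤ 4 * C₁ / Δ ^ ((1 : ℝ) / 6) * |(Θ - θ) ^ (-(1 / 2) : ℝ)| := by positivity
    simp only
    rw [Real.norm_of_nonneg (add_nonneg hr1 hr2), norm_mul, norm_div, norm_exp_sub_exp,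
      Complex.norm_real, Real.norm_of_nonneg (h0 θ)]
    have hnum : ‖Complex.exp ((θ : ℂ) * Complex.I) + Complex.exp ((Θ : ℂ) * Complex.I)‖ ≤ 2 := by
      refine (norm_add_le _ _).trans ?_
      rw [Complex.norm_exp_ofReal_mul_I, Complex.norm_exp_ofReal_mul_I]
      norm_num
    rcases lt_or_ge Θ |θ| with hs | hs
    · have : ρ θ = 0 := hsupp θ hs
      rw [this, mul_zero, mul_zero, zero_add]
      exact hr2
    rw [abs_le] at hs
    rcases eq_or_lt_of_le hs.2 with he | hlt
    · have hr := add_nonneg hr1 hr2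
      rw [he] at hr ⊢
      simpa only [sub_self, zero_div, Real.sin_zero, abs_zero, mul_zero, div_zero, zero_mul] using hr
    have hspos := sin_half_pos (p := Θ - θ) (by linarith) (by linarith)
    have hK : ‖Complex.exp ((θ : ℂ) * Complex.I) + Complex.exp ((Θ : ℂ) * Complex.I)‖ /
        (2 * |Real.sin ((Θ - θ) / 2)|) ≤ 1 / Real.sin ((Θ - θ) / 2) := by
      rw [abs_of_pos hspos, div_le_div_iff₀ (by positivity) hspos]
      nlinarith
    refine (mul_le_mul_of_nonneg_right hK (h0 θ)).trans ?_
    rcases lt_or_ge (Θ - θ) Δ with hd | hd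
    · refine le_add_of_nonneg_of_le hr1 ?_
      have hx : 0 < Θ - θ := by linarith
      have hb := (hnear (Θ - θ) hx hd).2
      rw [show Θ - (Θ - θ) = θ by ring] at hb
      have hsin : (Θ - θ) / 4 ≤ Real.sin ((Θ - θ) / 2) := by
        refine le_trans ?_ (Real.mul_le_sin (x := (Θ - θ) / 2) (by linarith) (by linarith))
        rw [div_mul_div_comm, div_le_div_iff₀ (by norm_num) (by positivity)]
        nlinarith [Real.pi_le_four]
      have hpw : |(Θ - θ) ^ (-(1 / 2) : ℝ)| = Real.sqrt (Θ - θ) / (Θ - θ) := by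
        rw [abs_of_pos (Real.rpow_pos_of_pos hx _), Real.rpow_neg hx.le, ← Real.sqrt_eq_rpow,
          Real.sqrt_div_self', one_div]
      have hρ : ρ θ ≤ C₁ * Real.sqrt (Θ - θ) / Δ ^ ((1 : ℝ) / 6) := by
        rw [le_div_iff₀ hΔp]; linarith
      rw [hpw]
      calc 1 / Real.sin ((Θ - θ) / 2) * ρ θ
          ≤ 1 / ((Θ - θ) / 4) * (C₁ * Real.sqrt (Θ - θ) / Δ ^ ((1 : ℝ) / 6)) :=
            mul_le_mul (one_div_le_one_div_of_le (by positivity) hsin) hρ (h0 θ) (by positivity)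
        _ = _ := by field_simp
    · refine le_add_of_le_of_nonneg (mul_le_mul_of_nonneg_right ?_ (h0 θ)) hr2
      refine one_div_le_one_div_of_le hmpos ?_
      rcases le_total (Θ - θ) Real.pi with hc | hc
      · exact Real.sin_le_sin_of_le_of_le_pi_div_two (by linarith) (by linarith) (by linarith)
      · rw [hm, ← Real.sin_pi_sub ((Θ - θ) / 2)]
        exact Real.sin_le_sin_of_le_of_le_pi_div_two (by linarith) (by linarith) (by linarith)

end IsCuspDensity

lemma im_cauchyTransformD {ρ : ℝ → ℝ} {r φ : ℝ} (hr : 0 < r)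
    (hint : IntervalIntegrable (fun θ : ℝ ↦
      ((Complex.exp ((θ : ℂ) * Complex.I) + (r : ℂ) * Complex.exp ((φ : ℂ) * Complex.I)) /
        (Complex.exp ((θ : ℂ) * Complex.I) - (r : ℂ) * Complex.exp ((φ : ℂ) * Complex.I))) *
        (ρ θ : ℂ)) MeasureTheory.volume (-Real.pi) Real.pi) :
    IntervalIntegrable (fun θ ↦ herglotzIm ((r - 1) ^ 2 / (2 * r)) (φ - θ) * ρ θ)
        MeasureTheory.volume (-Real.pi) Real.pi ∧
      (cauchyTransformD ρ ((r : ℂ) * Complex.exp ((φ : ℂ) * Complex.I))).im =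
        ∫ θ in (-Real.pi)..Real.pi, herglotzIm ((r - 1) ^ 2 / (2 * r)) (φ - θ) * ρ θ := by
  have hfun : ∀ θ : ℝ, herglotzIm ((r - 1) ^ 2 / (2 * r)) (φ - θ) * ρ θ =
      Complex.imCLM (((Complex.exp ((θ : ℂ) * Complex.I) +
          (r : ℂ) * Complex.exp ((φ : ℂ) * Complex.I)) /
        (Complex.exp ((θ : ℂ) * Complex.I) - (r : ℂ) * Complex.exp ((φ : ℂ) * Complex.I))) *
        (ρ θ : ℂ)) := by
    intro θ
    rw [Complex.imCLM_apply, Complex.im_mul_ofReal, im_herglotz_kernel r θ φ hr]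
  simp_rw [hfun]
  refine ⟨⟨Complex.imCLM.integrable_comp hint.1, Complex.imCLM.integrable_comp hint.2⟩, ?_⟩
  rw [Complex.imCLM.intervalIntegral_comp_comm hint, Complex.imCLM_apply, cauchyTransformD]

/-- Integrating over a symmetric interval by folding onto the positive half. -/
lemma intervalIntegral_symm_eq {g : ℝ → ℝ} {a : ℝ} (ha : 0 ≤ a)
    (hg : IntervalIntegrable g MeasureTheory.volume (-a) a) :
    IntervalIntegrable (fun x ↦ g x + g (-x)) MeasureTheory.volume 0 a ∧
      ∫ x in (-a)..a, g x = ∫ x in (0 : ℝ)..a, (g x + g (-x)) := by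
  have h1 : IntervalIntegrable g MeasureTheory.volume 0 a :=
    hg.mono_set (by rw [Set.uIcc_of_le ha, Set.uIcc_of_le (by linarith)]
                    exact Set.Icc_subset_Icc_left (by linarith))
  have h2 : IntervalIntegrable g MeasureTheory.volume (-a) 0 :=
    hg.mono_set (by rw [Set.uIcc_of_le (by linarith), Set.uIcc_of_le (by linarith)]
                    exact Set.Icc_subset_Icc_right (by linarith))
  have h3 : IntervalIntegrable (fun x ↦ g (-x)) MeasureTheory.volume 0 a := by
    simpa using (h2.comp_sub_left 0).symm
  refine ⟨h1.add h3, ?_⟩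
  rw [intervalIntegral.integral_add h1 h3, intervalIntegral.integral_comp_neg, neg_zero, add_comm,
    intervalIntegral.integral_add_adjacent_intervals h2 h1]

/-- For a near-cusp density as above, there exist `c₁ ∈ (0, 1/2)` and
`d > 0`, depending only on `C₁`, such that for `z = (1+η)·e^{i(Θ+κ)}` with
`0 < η < c₁·Δ` and `0 < κ < Δ/2` one has
`Im f_ρ(z) − Im f_ρ(e^{iΘ}) ≤ −d·Δ^{−1/6}·√κ`. -/
theorem stmt_9 (C₁ : ℝ) (hC₁ : 0 < C₁) :
    ∃ c₁ d : ℝ, 0 < c₁ ∧ c₁ < 1 / 2 ∧ 0 < d ∧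
      ∀ Δ : ℝ, 0 < Δ → Δ < 1 / 100 →
      ∀ ρ : ℝ → ℝ, IsCuspDensity Δ C₁ ρ →
      ∀ η κ : ℝ, 0 < η → η < c₁ * Δ → 0 < κ → κ < Δ / 2 →
        (cauchyTransformD ρ
              (((1 + η : ℝ) : ℂ) *
                Complex.exp (((Real.pi - Δ / 2 + κ : ℝ) : ℂ) * Complex.I))).im -
            (cauchyTransformD ρ
              (Complex.exp (((Real.pi - Δ / 2 : ℝ) : ℂ) * Complex.I))).im ≤
          -d * Δ ^ (-(1 : ℝ) / 6) * Real.sqrt κ := by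
  refine ⟨1 / 4, 1 / (8 * C₁), by norm_num, by norm_num, by positivity, ?_⟩
  intro Δ hΔ0 hΔ1 ρ hρ η κ hη _ hκ hκΔ
  have hpi := Real.pi_gt_three
  have hz : ‖((1 + η : ℝ) : ℂ) *
      Complex.exp (((Real.pi - Δ / 2 + κ : ℝ) : ℂ) * Complex.I)‖ ≠ 1 := by
    rw [norm_mul, Complex.norm_exp_ofReal_mul_I, Complex.norm_real,
      Real.norm_of_nonneg (by linarith)]
    linarith
  obtain ⟨i1, e1⟩ := im_cauchyTransformD (by linarith) (hρ.cauchyKernel_intervalIntegrable hz)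
  obtain ⟨i2, e2⟩ := im_cauchyTransformD (ρ := ρ) (r := 1) (φ := Real.pi - Δ / 2) one_pos
    (by simpa using hρ.cauchyKernel_edge_intervalIntegrable hC₁ hΔ0 hΔ1)
  simp only [Complex.ofReal_one, one_mul] at e2
  norm_num only at i2 e2
  have he : 0 ≤ (1 + η - 1) ^ 2 / (2 * (1 + η)) := by positivity
  rw [e1, e2, ← intervalIntegral.integral_sub i1 i2]
  set e := (1 + η - 1) ^ 2 / (2 * (1 + η))
  obtain ⟨hi, hs⟩ := intervalIntegral_symm_eq Real.pi_pos.le (i1.sub i2)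
  rw [hs]
  obtain ⟨h0, -, hsymm, hsupp, hnear, -⟩ := hρ
  set Θ := Real.pi - Δ / 2 with hΘ
  have hpt : ∀ θ, 0 < θ → θ < Θ →
      (herglotzIm e (Θ + κ - θ) * ρ θ - herglotzIm 0 (Θ - θ) * ρ θ) +
        (herglotzIm e (Θ + κ - -θ) * ρ (-θ) - herglotzIm 0 (Θ - -θ) * ρ (-θ)) ≤
      (herglotzIm 0 (Θ - θ + κ) - herglotzIm 0 (Θ - θ)) * ρ θ := by
    intro θ hθ0 hθ
    have h := herglotzIm_symm_le (y := Θ - θ) he hκ hκΔ (by linarith) (by linarith) (by linarith)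
    rw [← hsymm θ, show Θ + κ - -θ = 2 * Real.pi - (Δ + (Θ - θ) - κ) by rw [hΘ]; ring,
      show Θ - -θ = 2 * Real.pi - (Δ + (Θ - θ)) by rw [hΘ]; ring,
      show Θ + κ - θ = Θ - θ + κ by ring, herglotzIm_two_pi_sub, herglotzIm_two_pi_sub]
    nlinarith [mul_le_mul_of_nonneg_right h (h0 θ)]
  have hΔp : 0 < Δ ^ ((1 : ℝ) / 6) := Real.rpow_pos_of_pos hΔ0 _
  have hκs : 0 < Real.sqrt κ := Real.sqrt_pos.mpr hκ
  set M := 1 / (4 * C₁) * (Δ ^ ((1 : ℝ) / 6))⁻¹ * (Real.sqrt κ)⁻¹ with hM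
  have hneg : ∀ᵐ θ ∂MeasureTheory.volume.restrict (Set.Ioc 0 Real.pi),
      0 ≤ -((herglotzIm e (Θ + κ - θ) * ρ θ - herglotzIm 0 (Θ - θ) * ρ θ) +
        (herglotzIm e (Θ + κ - -θ) * ρ (-θ) - herglotzIm 0 (Θ - -θ) * ρ (-θ))) := by
    filter_upwards [MeasureTheory.ae_restrict_mem measurableSet_Ioc,
      MeasureTheory.ae_restrict_of_ae (MeasureTheory.Measure.ae_ne MeasureTheory.volume Θ)]
      with θ hθ hne
    rcases lt_or_gt_of_ne hne with hlt | hgt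
    · have hmono := herglotzIm_zero_antitone (p := Θ - θ) (q := Θ - θ + κ) (by linarith)
        (by linarith) (by linarith [hθ.1])
      nlinarith [hpt θ hθ.1 hlt, h0 θ]
    · rw [← hsymm θ, hsupp θ (by rwa [abs_of_pos hθ.1])]
      simp
  have hlow : ∀ θ ∈ Set.Icc (Θ - κ) (Θ - κ / 2),
      M ≤ -((herglotzIm e (Θ + κ - θ) * ρ θ - herglotzIm 0 (Θ - θ) * ρ θ) +
        (herglotzIm e (Θ + κ - -θ) * ρ (-θ) - herglotzIm 0 (Θ - -θ) * ρ (-θ))) := by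
    intro θ hθ
    have hy : 0 < Θ - θ := by linarith [hθ.2]
    have hyκ : Θ - θ ≤ κ := by linarith [hθ.1]
    have h1 := hpt θ (by linarith) (by linarith)
    have h2 := herglotzIm_zero_add_sub_le hκ (by linarith) hy hyκ
    have h3 := (hnear (Θ - θ) hy (by linarith)).1
    rw [show Θ - (Θ - θ) = θ by ring] at h3
    have h4 : M ≤ 1 / (2 * (Θ - θ)) * ρ θ := by
      have hsq : (Real.sqrt κ)⁻¹ ≤ Real.sqrt (Θ - θ) / (Θ - θ) := by
        rw [Real.sqrt_div_self', ← one_div]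
        exact one_div_le_one_div_of_le (Real.sqrt_pos.mpr hy) (Real.sqrt_le_sqrt hyκ)
      have hρl : C₁⁻¹ * Real.sqrt (Θ - θ) * (Δ ^ ((1 : ℝ) / 6))⁻¹ ≤ ρ θ := by
        rw [← div_eq_mul_inv, div_le_iff₀ hΔp]; linarith
      calc M ≤ 1 / (4 * C₁) * (Δ ^ ((1 : ℝ) / 6))⁻¹ * (Real.sqrt (Θ - θ) / (Θ - θ)) := by
            rw [hM]; gcongr
        _ ≤ 1 / (2 * C₁) * (Δ ^ ((1 : ℝ) / 6))⁻¹ * (Real.sqrt (Θ - θ) / (Θ - θ)) := by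
            gcongr; norm_num
        _ = 1 / (2 * (Θ - θ)) * (C₁⁻¹ * Real.sqrt (Θ - θ) * (Δ ^ ((1 : ℝ) / 6))⁻¹) := by
            field_simp
        _ ≤ _ := by gcongr
    nlinarith [mul_le_mul_of_nonneg_right h2 (h0 θ)]
  have hi' := hi.neg
  have hmono := intervalIntegral.integral_mono_interval (c := 0) (d := Real.pi)
    (a := Θ - κ) (b := Θ - κ / 2) (by linarith) (by linarith) (by linarith) hneg hi'
  have hsub : IntervalIntegrable _ MeasureTheory.volume (Θ - κ) (Θ - κ / 2) :=
    hi'.mono_set (by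
      rw [Set.uIcc_of_le (by linarith), Set.uIcc_of_le (by linarith)]
      exact Set.Icc_subset_Icc (by linarith) (by linarith))
  have hconst := intervalIntegral.integral_mono_on (by linarith)
    (intervalIntegrable_const (c := M)) hsub hlow
  rw [intervalIntegral.integral_const, smul_eq_mul] at hconst
  have hfin : (Θ - κ / 2 - (Θ - κ)) * M =
      1 / (8 * C₁) * Δ ^ (-(1 : ℝ) / 6) * Real.sqrt κ := by
    rw [hM, neg_div, Real.rpow_neg hΔ0.le]
    have : κ = Real.sqrt κ * Real.sqrt κ := (Real.mul_self_sqrt hκ.le).symm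
    field_simp
    linear_combination 8 * this
  have := hconst.trans hmono
  rw [hfin, intervalIntegral.integral_neg] at this
  simp only [neg_mul]
  linarith
end
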